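/- arXiv:2308.04695 — 8 statements merged into one kernel-verified Lean document; each statement's English description precedes it below -/
import Mathlib

section
/- Let G = (V,E) be a finite simple undirected graph with terminal set T ⊆ V, let k ≥ 1, and let (L,S,R) be a T-Steiner cut of G. Let K_R ⊆ R with |K_R| = k and a designated terminal t_R ∈ K_R, and let G_L be the k-left graph of G with respect to (L,S,R) (vertex set L ∪ S ∪ K_R; edges: all edges of G inside L ∪ S, all pairs inside K_R, and all pairs between S and K_R). Symmetrically let K_L ⊆ L with |K_L| = k, t_L ∈ K_L, and let G_R be the k-right graph (vertex set K_L ∪ S ∪ R; edges: all edges of G inside S ∪ R, all pairs inside K_L, and all pairs between S and K_L). Write T_L = T ∩ L and T_R = T ∩ R. If κ_G(T) < k, then min{ κ_G(S), κ_{G_L}(T_L ∪ {t_R}), κ_{G_R}(T_R ∪ {t_L}) } < k. -/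
open scoped Classical

variable {V : Type} [Fintype V] [DecidableEq V]

/-- `(L,S,R)` is a vertex cut of the graph `G`: a partition of the vertex set into
`L`, `S`, `R` with `L` and `R` nonempty and no edge between `L` and `R`. -/
def IsVertexCut (G : SimpleGraph V) (L S R : Finset V) : Prop :=
  L.Nonempty ∧ R.Nonempty ∧
    Disjoint L S ∧ Disjoint L R ∧ Disjoint S R ∧
    L ∪ S ∪ R = Finset.univ ∧
    ∀ x ∈ L, ∀ y ∈ R, ¬ G.Adj x y

/-- A `T`-Steiner cut: a vertex cut with terminals on both sides. -/
def IsSteinerCut (G : SimpleGraph V) (T L S R : Finset V) : Prop :=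
  IsVertexCut G L S R ∧ (T ∩ L).Nonempty ∧ (T ∩ R).Nonempty

/-- `S` separates `x` and `y` in `G`: `x, y ∉ S` and every walk from `x` to `y` meets `S`. -/
def Separates (G : SimpleGraph V) (S : Finset V) (x y : V) : Prop :=
  x ∉ S ∧ y ∉ S ∧ ∀ p : G.Walk x y, ∃ v ∈ p.support, v ∈ S

/-- `S` is a vertex separator of `G`: deleting `S` disconnects some pair of vertices. -/
def IsSeparator (G : SimpleGraph V) (S : Finset V) : Prop :=
  ∃ x y : V, x ≠ y ∧ Separates G S x y

/-- `κ_G(x,y)`: minimum size of a set separating `x` and `y`, or `|V| - 1` if none exists. -/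
noncomputable def kappaPair (G : SimpleGraph V) (x y : V) : ℕ :=
  if ∃ S : Finset V, Separates G S x y then
    sInf {n | ∃ S : Finset V, Separates G S x y ∧ S.card = n}
  else Fintype.card V - 1

/-- Steiner connectivity `κ_G(T) = min_{x ≠ y ∈ T} κ_G(x,y)`, or `|V| - 1` if `|T| ≤ 1`. -/
noncomputable def kappaT (G : SimpleGraph V) (T : Finset V) : ℕ :=
  if 2 ≤ T.card then
    sInf {n | ∃ x ∈ T, ∃ y ∈ T, x ≠ y ∧ kappaPair G x y = n}
  else Fintype.card V - 1

/-- Vertex connectivity of `G`: the minimum size of a vertex cut. -/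
noncomputable def vconn (G : SimpleGraph V) : ℕ :=
  sInf {n | ∃ L S R : Finset V, IsVertexCut G L S R ∧ S.card = n}

/-- The neighborhood `N_G(U)`: vertices outside `U` with a neighbor in `U`. -/
noncomputable def nbrFinset (G : SimpleGraph V) (U : Finset V) : Finset V :=
  Finset.univ.filter fun w => w ∉ U ∧ ∃ u ∈ U, G.Adj w u

/-- `X` is an `(α,β)`-vertex expander. -/
def IsVertexExpander (X : SimpleGraph V) (α β : ℝ) : Prop :=
  ∀ L : Finset V, (L.card : ℝ) ≤ α * (Fintype.card V : ℝ) →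
    β * (L.card : ℝ) ≤ ((nbrFinset X L).card : ℝ)

/-- `G` is a `(T,φ)`-vertex expander: every vertex cut with terminals (counting the
separator) on both sides has terminal expansion at least `φ`. -/
def IsTerminalExpander (G : SimpleGraph V) (T : Finset V) (φ : ℝ) : Prop :=
  ∀ L S R : Finset V, IsVertexCut G L S R →
    0 < min (T ∩ (L ∪ S)).card (T ∩ (R ∪ S)).card →
    φ * ((min (T ∩ (L ∪ S)).card (T ∩ (R ∪ S)).card : ℕ) : ℝ) ≤ (S.card : ℝ)

/-- The cut `(L,S,R)` isolates `T'`: `|T' ∩ L| = 1`, `|T' ∩ S| = 0`, `|T' ∩ R| ≥ 1`. -/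
def Isolates (L S R T' : Finset V) : Prop :=
  (T' ∩ L).card = 1 ∧ (T' ∩ S).card = 0 ∧ 1 ≤ (T' ∩ R).card

/-- `C` is a `(v,W)`-separator: `v ∉ C`, `W ∩ C = ∅`, and every walk from `v` to a
vertex of `W` meets `C`. -/
def SeparatesSet (G : SimpleGraph V) (C : Finset V) (v : V) (W : Finset V) : Prop :=
  v ∉ C ∧ (∀ w ∈ W, w ∉ C) ∧ ∀ w ∈ W, ∀ p : G.Walk v w, ∃ u ∈ p.support, u ∈ C

/-- The `k`-left graph of `G` w.r.t. a vertex cut, with `A` the kept side, `S` the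
separator and `K` the clique replacing the other side: vertex set `A ∪ S ∪ K`,
edges of `G` inside `A ∪ S`, all pairs inside `K`, and all pairs between `S` and `K`. -/
def kLeftGraph (G : SimpleGraph V) (A S K : Finset V) :
    SimpleGraph {v : V // v ∈ A ∪ S ∪ K} :=
  SimpleGraph.fromRel fun u v =>
    ((u : V) ∈ A ∪ S ∧ (v : V) ∈ A ∪ S ∧ G.Adj (u : V) (v : V)) ∨
    ((u : V) ∈ K ∧ (v : V) ∈ K) ∨
    ((u : V) ∈ S ∧ (v : V) ∈ K)

/-- The subgraph of `G` induced on a finite vertex set `U`. -/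
def inducedOn (G : SimpleGraph V) (U : Finset V) : SimpleGraph {v : V // v ∈ U} :=
  SimpleGraph.comap (fun v => (v : V)) G

/-- The quotient graph of `G` on a partition `Ps`: parts are adjacent iff `G` has an
edge between them. -/
def quotientGraph (G : SimpleGraph V) (Ps : Finset (Finset V)) :
    SimpleGraph {P : Finset V // P ∈ Ps} :=
  SimpleGraph.fromRel fun P Q => ∃ x ∈ (P : Finset V), ∃ y ∈ (Q : Finset V), G.Adj x y

theorem kappaPair_le_of_separates {V : Type} [Fintype V] {G : SimpleGraph V} {C : Finset V}
    {x y : V} (h : Separates G C x y) : kappaPair G x y ≤ C.card := by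
  unfold kappaPair
  rw [if_pos ⟨C, h⟩]
  exact Nat.sInf_le ⟨C, h, rfl⟩

theorem kappaT_le_of_separates {V : Type} [Fintype V] {G : SimpleGraph V} {T C : Finset V}
    {x y : V} (hx : x ∈ T) (hy : y ∈ T) (hxy : x ≠ y) (h : Separates G C x y) :
    kappaT G T ≤ C.card := by
  unfold kappaT
  rw [if_pos (show 2 ≤ T.card from Finset.one_lt_card.mpr ⟨x, hx, y, hy, hxy⟩)]
  have hle := kappaPair_le_of_separates h
  refine le_trans (Nat.sInf_le ?_) hle
  exact ⟨x, hx, y, hy, hxy, rfl⟩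

/-- A Steiner connectivity below `k ≤ |V| - 1` is witnessed by a separator of size below `k`. -/
theorem exists_separates_of_kappaT_lt {V : Type} [Fintype V] {G : SimpleGraph V} {T : Finset V}
    {k : ℕ} (hk : k ≤ Fintype.card V - 1) (h : kappaT G T < k) :
    ∃ x ∈ T, ∃ y ∈ T, ∃ C : Finset V, Separates G C x y ∧ C.card < k := by
  unfold kappaT at h
  split_ifs at h with hT
  · obtain ⟨a, ha, b, hb, hab⟩ := Finset.one_lt_card.mp hT
    obtain ⟨x, hx, y, hy, -, hxy⟩ := Nat.sInf_mem
      (s := {n | ∃ x ∈ T, ∃ y ∈ T, x ≠ y ∧ kappaPair G x y = n}) ⟨_, a, ha, b, hb, hab, rfl⟩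
    rw [← hxy] at h
    unfold kappaPair at h
    split_ifs at h with hS
    · obtain ⟨D, hD⟩ := hS
      obtain ⟨C, hC, hcard⟩ := Nat.sInf_mem
        (s := {n | ∃ S : Finset V, Separates G S x y ∧ S.card = n}) ⟨_, D, hD, rfl⟩
      exact ⟨x, hx, y, hy, C, hC, hcard ▸ h⟩
    · omega
  · omega

/-- In the `k`-left graph, a walk leaving the kept side `A` first passes, inside `G`, through
the separator. -/
theorem exists_walk_to_separator {V : Type} {G : SimpleGraph V} [DecidableEq V]
    {A S K C : Finset V} (hAS : Disjoint A S) (hAK : Disjoint A K)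
    {u v : {v : V // v ∈ A ∪ S ∪ K}} (p : (kLeftGraph G A S K).Walk u v)
    (hu : (u : V) ∈ A) (hv : (v : V) ∉ A)
    (hp : ∀ a ∈ p.support, (a : V) ∈ A ∪ S → (a : V) ∉ C) :
    ∃ s ∈ S, ∃ q : G.Walk u s, ∀ a ∈ q.support, a ∉ C := by
  induction p with
  | nil => exact absurd hu hv
  | @cons u w v h p ih =>
    have huS := Finset.disjoint_left.mp hAS hu
    have huK := Finset.disjoint_left.mp hAK hu
    have huC : (u : V) ∉ C := hp u (by simp) (Finset.mem_union_left _ hu)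
    obtain ⟨hw, hadj⟩ : (w : V) ∈ A ∪ S ∧ G.Adj u w := by
      simp only [kLeftGraph, SimpleGraph.fromRel_adj] at h
      rcases h.2 with (h | h | h) | (h | h | h)
      · exact h.2
      · exact absurd h.1 huK
      · exact absurd h.1 huS
      · exact ⟨h.1, h.2.2.symm⟩
      · exact absurd h.2 huK
      · exact absurd h.2 huK
    rcases Finset.mem_union.mp hw with hwA | hwS
    · obtain ⟨s, hs, q, hq⟩ := ih hwA hv fun a ha => hp a (by simp [ha])
      refine ⟨s, hs, .cons hadj q, fun a ha => ?_⟩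
      rw [SimpleGraph.Walk.support_cons, List.mem_cons] at ha
      rcases ha with rfl | ha
      · exact huC
      · exact hq a ha
    · refine ⟨w, hwS, .cons hadj .nil, fun a ha => ?_⟩
      simp only [SimpleGraph.Walk.support_cons, SimpleGraph.Walk.support_nil, List.mem_cons,
        List.not_mem_nil, or_false] at ha
      rcases ha with rfl | rfl
      · exact huC
      · exact hp w (by simp) hw

theorem kappaT_kLeftGraph_le {V : Type} [Fintype V] [DecidableEq V] {G : SimpleGraph V}
    {T A S K C : Finset V} (hAS : Disjoint A S) (hAK : Disjoint A K) (hSK : Disjoint S K)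
    {t x : V} (ht : t ∈ K) (hxT : x ∈ T) (hxA : x ∈ A) (hxC : x ∉ C)
    (hx : ∀ s ∈ S, ∀ p : G.Walk x s, ∃ v ∈ p.support, v ∈ C) :
    kappaT (kLeftGraph G A S K) (Finset.subtype (· ∈ A ∪ S ∪ K) ((T ∩ A) ∪ {t})) ≤ C.card := by
  have htA : t ∉ A := Finset.disjoint_right.mp hAK ht
  have htS : t ∉ S := Finset.disjoint_right.mp hSK ht
  have hsep : Separates (kLeftGraph G A S K)
      (Finset.subtype (· ∈ A ∪ S ∪ K) (C ∩ (A ∪ S)))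
      ⟨x, by simp [hxA]⟩ ⟨t, by simp [ht]⟩ := by
    refine ⟨by simp [hxC], by simp [htA, htS], fun p => ?_⟩
    by_contra! hp
    obtain ⟨s, hs, q, hq⟩ := exists_walk_to_separator (C := C) hAS hAK p hxA htA
      fun a ha haAS haC => hp a ha (Finset.mem_subtype.mpr (Finset.mem_inter.mpr ⟨haC, haAS⟩))
    obtain ⟨v, hv, hvC⟩ := hx s hs q
    exact hq v hv hvC
  refine (kappaT_le_of_separates (by simp [hxA, hxT]) (by simp) ?_ hsep).trans ?_
  · intro h
    have hxt : x = t := congrArg Subtype.val h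
    exact htA (hxt ▸ hxA)
  · rw [Finset.card_subtype]
    exact (Finset.card_filter_le _ _).trans (Finset.card_le_card Finset.inter_subset_left)

/-- If `C` separates `x` from `y` but no two vertices of `S`, then it cuts `x` or `y` off `S`. -/
theorem Separates.cutoff_or_cutoff {V : Type} {G : SimpleGraph V} {S C : Finset V} {x y : V}
    (h : Separates G C x y) (hS : ∀ s ∈ S, ∀ t ∈ S, s ≠ t → ¬ Separates G C s t) :
    (∀ s ∈ S, ∀ p : G.Walk x s, ∃ v ∈ p.support, v ∈ C) ∨
      (∀ s ∈ S, ∀ p : G.Walk y s, ∃ v ∈ p.support, v ∈ C) := by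
  by_contra! hcon
  obtain ⟨⟨s, hs, p, hp⟩, t, ht, q, hq⟩ := hcon
  have hjoin : ∀ r : G.Walk s t, ∃ v ∈ r.support, v ∈ C := by
    intro r
    obtain ⟨v, hv, hvC⟩ := h.2.2 ((p.append r).append q.reverse)
    simp only [SimpleGraph.Walk.mem_support_append_iff, SimpleGraph.Walk.support_reverse,
      List.mem_reverse] at hv
    rcases hv with (hv | hv) | hv
    · exact absurd hvC (hp v hv)
    · exact ⟨v, hv, hvC⟩
    · exact absurd hvC (hq v hv)
  have hsC : s ∉ C := hp s p.end_mem_support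
  by_cases hst : s = t
  · subst hst
    obtain ⟨v, hv, hvC⟩ := hjoin .nil
    simp only [SimpleGraph.Walk.support_nil, List.mem_singleton] at hv
    exact hsC (hv ▸ hvC)
  · exact hS s hs t ht hst ⟨hsC, hq t q.end_mem_support, hjoin⟩

/-- if `κ_G(T) < k` then
`min{κ_G(S), κ_{G_L}(T_L ∪ {t_R}), κ_{G_R}(T_R ∪ {t_L})} < k`, where `G_L`, `G_R`
are the `k`-left and `k`-right graphs of `G` w.r.t. the `T`-Steiner cut `(L,S,R)`. -/
theorem statement_1 {V : Type} [Fintype V] [DecidableEq V]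
    (G : SimpleGraph V) (T : Finset V) (k : ℕ) (hk : 1 ≤ k)
    (L S R : Finset V) (hcut : IsSteinerCut G T L S R)
    (KR : Finset V) (hKRsub : KR ⊆ R) (hKRcard : KR.card = k)
    (tR : V) (htR : tR ∈ KR)
    (KL : Finset V) (hKLsub : KL ⊆ L) (hKLcard : KL.card = k)
    (tL : V) (htL : tL ∈ KL)
    (hT : kappaT G T < k) :
    min (kappaT G S)
      (min
        (kappaT (kLeftGraph G L S KR)
          (Finset.subtype (· ∈ L ∪ S ∪ KR) ((T ∩ L) ∪ {tR})))
        (kappaT (kLeftGraph G R S KL)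
          (Finset.subtype (· ∈ R ∪ S ∪ KL) ((T ∩ R) ∪ {tL})))) < k := by
  obtain ⟨⟨-, -, hLS, hLR, hSR, huniv, -⟩, -, -⟩ := hcut
  have hcard : k ≤ Fintype.card V - 1 := by
    have h := Finset.card_le_univ (KR ∪ KL)
    rw [Finset.card_union_of_disjoint
      (Finset.disjoint_of_subset_left hKRsub (Finset.disjoint_of_subset_right hKLsub hLR.symm))] at h
    omega
  obtain ⟨x, hx, y, hy, C, hC, hCk⟩ := exists_separates_of_kappaT_lt hcard hT
  by_contra! hmin
  obtain ⟨hS, hL, hR⟩ : k ≤ kappaT G S ∧ _ ∧ _ := by simpa only [le_min_iff] using hmin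
  have main : ∀ z ∈ T, z ∉ C → ¬ ∀ s ∈ S, ∀ p : G.Walk z s, ∃ v ∈ p.support, v ∈ C := by
    intro z hz hzC hzS
    have hmem : z ∈ L ∪ S ∪ R := huniv ▸ Finset.mem_univ z
    rcases Finset.mem_union.mp hmem with h | h
    · rcases Finset.mem_union.mp h with h | h
      · exact (hCk.trans_le hL).not_ge (kappaT_kLeftGraph_le hLS
          (Finset.disjoint_of_subset_right hKRsub hLR)
          (Finset.disjoint_of_subset_right hKRsub hSR) htR hz h hzC hzS)
      · obtain ⟨v, hv, hvC⟩ := hzS z h .nil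
        simp only [SimpleGraph.Walk.support_nil, List.mem_singleton] at hv
        exact hzC (hv ▸ hvC)
    · exact (hCk.trans_le hR).not_ge (kappaT_kLeftGraph_le hSR.symm
        (Finset.disjoint_of_subset_right hKLsub hLR.symm)
        (Finset.disjoint_of_subset_right hKLsub hLS.symm) htL hz h hzC hzS)
  have hSC : ∀ s ∈ S, ∀ t ∈ S, s ≠ t → ¬ Separates G C s t := fun s hs t ht hst hsep =>
    (hCk.trans_le hS).not_ge (kappaT_le_of_separates hs ht hst hsep)
  rcases hC.cutoff_or_cutoff hSC with h | h
  · exact main x hx hC.1 h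
  · exact main y hy hC.2.1 h
end

section
/- Let G = (V,E) be a finite simple undirected graph, let k ≥ 1, let (L,S,R) be a vertex cut of G, and let G_L be the k-left graph of G with respect to (L,S,R) (vertex set L ∪ S ∪ K_R for some K_R ⊆ R with |K_R| = k; edges: all edges of G inside L ∪ S, all pairs inside K_R, and all pairs between S and K_R). Then every vertex separator of G_L of size less than k is also a vertex separator of G. The same holds with the k-right graph G_R in place of G_L. -/
open scoped Classical

variable {V : Type} [Fintype V] [DecidableEq V]

theorem Separates.symm {W : Type} {H : SimpleGraph W} {C : Finset W} {x y : W}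
    (h : Separates H C x y) : Separates H C y x := by
  refine ⟨h.2.1, h.1, fun p => ?_⟩
  obtain ⟨v, hv, hvC⟩ := h.2.2 p.reverse
  exact ⟨v, by simpa using hv, hvC⟩

/-- A vertex outside a separating set is separated from at least one of the two
separated vertices. -/
theorem Separates.left_or_right {W : Type} {H : SimpleGraph W} {C : Finset W} {x y c : W}
    (h : Separates H C x y) (hc : c ∉ C) : Separates H C x c ∨ Separates H C y c := by
  by_contra! hcon
  simp only [Separates, h.1, h.2.1, hc, not_false_eq_true, true_and, not_forall] at hcon
  obtain ⟨⟨p, hp⟩, q, hq⟩ := hcon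
  obtain ⟨v, hv, hvC⟩ := h.2.2 (p.append q.reverse)
  rw [SimpleGraph.Walk.mem_support_append_iff, SimpleGraph.Walk.support_reverse,
    List.mem_reverse] at hv
  exact hv.elim (fun hv => hp ⟨v, hv, hvC⟩) (fun hv => hq ⟨v, hv, hvC⟩)

/-- If `x` is separated by `C` from a vertex of the clique `K` in the `k`-left graph, then every
walk of `G` from `x` avoiding `C` stays in the `k`-left graph. -/
theorem exists_kLeftGraph_walk {V : Type} [Fintype V] [DecidableEq V]
    {G : SimpleGraph V} {A S B K : Finset V}
    (hcover : A ∪ S ∪ B = Finset.univ) (hAB : ∀ x ∈ A, ∀ y ∈ B, ¬ G.Adj x y)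
    {C : Finset {v : V // v ∈ A ∪ S ∪ K}} {x c : {v : V // v ∈ A ∪ S ∪ K}}
    (hcK : (c : V) ∈ K) (hxc : Separates (kLeftGraph G A S K) C x c)
    {z w : V} (p : G.Walk z w) :
    ∀ hz : z ∈ A ∪ S ∪ K,
    (∃ q : (kLeftGraph G A S K).Walk x ⟨z, hz⟩, ∀ v ∈ q.support, v ∉ C) →
    (∀ v ∈ p.support, v ∉ C.image Subtype.val) →
    ∃ hw : w ∈ A ∪ S ∪ K,
      ∃ q : (kLeftGraph G A S K).Walk x ⟨w, hw⟩, ∀ v ∈ q.support, v ∉ C := by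
  induction p with
  | nil => exact fun hz hq _ => ⟨hz, hq⟩
  | @cons z u w hadj p ih =>
    rintro hz ⟨q, hq⟩ hp
    have hzSK : ¬ (z ∈ S ∨ z ∈ K) := by
      intro hzSK
      by_cases hzc : (⟨z, hz⟩ : {v : V // v ∈ A ∪ S ∪ K}) = c
      · subst hzc
        obtain ⟨v, hv, hvC⟩ := hxc.2.2 q
        exact hq v hv hvC
      · have hzc' : (kLeftGraph G A S K).Adj ⟨z, hz⟩ c := by
          rw [kLeftGraph, SimpleGraph.fromRel_adj]
          exact ⟨hzc, Or.inl (by tauto)⟩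
        obtain ⟨v, hv, hvC⟩ := hxc.2.2 (q.concat hzc')
        rw [SimpleGraph.Walk.support_concat, List.mem_append, List.mem_singleton] at hv
        rcases hv with hv | rfl
        · exact hq v hv hvC
        · exact hxc.2.1 hvC
    have hzA : z ∈ A := by
      simp only [Finset.mem_union] at hz
      tauto
    have huAS : u ∈ A ∪ S := by
      have hu : u ∈ A ∪ S ∪ B := hcover ▸ Finset.mem_univ u
      exact (Finset.mem_union.mp hu).resolve_right fun huB => hAB z hzA u huB hadj
    have hu : u ∈ A ∪ S ∪ K := Finset.mem_union_left _ huAS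
    have hzu : (kLeftGraph G A S K).Adj ⟨z, hz⟩ ⟨u, hu⟩ := by
      rw [kLeftGraph, SimpleGraph.fromRel_adj]
      exact ⟨fun h => hadj.ne (congrArg Subtype.val h),
        Or.inl (Or.inl ⟨Finset.mem_union_left _ hzA, huAS, hadj⟩)⟩
    refine ih hu ⟨q.concat hzu, fun v hv hvC => ?_⟩ fun v hv => hp v (by simp [hv])
    rw [SimpleGraph.Walk.support_concat, List.mem_append, List.mem_singleton] at hv
    rcases hv with hv | rfl
    · exact hq v hv hvC
    · exact hp u (by simp) (Finset.mem_image_of_mem Subtype.val hvC)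

theorem isSeparator_image_of_kLeftGraph {V : Type} [Fintype V] [DecidableEq V]
    {G : SimpleGraph V} {A S B K : Finset V}
    (hcover : A ∪ S ∪ B = Finset.univ) (hAB : ∀ x ∈ A, ∀ y ∈ B, ¬ G.Adj x y)
    {C : Finset {v : V // v ∈ A ∪ S ∪ K}} (hcard : C.card < K.card)
    (hC : IsSeparator (kLeftGraph G A S K) C) :
    IsSeparator G (C.image Subtype.val) := by
  obtain ⟨c, hcK, hcC⟩ := Finset.exists_mem_notMem_of_card_lt_card
    ((Finset.card_image_le (s := C) (f := Subtype.val)).trans_lt hcard)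
  let c' : {v : V // v ∈ A ∪ S ∪ K} := ⟨c, Finset.mem_union_right _ hcK⟩
  have hc'C : c' ∉ C := fun h => hcC (Finset.mem_image_of_mem Subtype.val h)
  obtain ⟨x, y, hxy, hsep, hxc⟩ : ∃ x y, x ≠ y ∧ Separates (kLeftGraph G A S K) C x y ∧
      Separates (kLeftGraph G A S K) C x c' := by
    obtain ⟨x, y, hxy, hsep⟩ := hC
    rcases hsep.left_or_right hc'C with h | h
    · exact ⟨x, y, hxy, hsep, h⟩
    · exact ⟨y, x, hxy.symm, hsep.symm, h⟩
  refine ⟨x, y, Subtype.coe_injective.ne hxy, ?_, ?_, fun p => ?_⟩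
  · simpa using hsep.1
  · simpa using hsep.2.1
  · by_contra! hp
    obtain ⟨_, q, hq⟩ := exists_kLeftGraph_walk hcover hAB hcK hxc p x.2
      ⟨SimpleGraph.Walk.nil, by simpa using hsep.1⟩ hp
    obtain ⟨v, hv, hvC⟩ := hsep.2.2 q
    exact hq v hv hvC

/-- every vertex separator of the `k`-left graph `G_L` (resp. the
`k`-right graph `G_R`) of size less than `k` is also a vertex separator of `G`. -/
theorem statement_2 {V : Type} [Fintype V] [DecidableEq V]
    (G : SimpleGraph V) (k : ℕ) (hk : 1 ≤ k)
    (L S R : Finset V) (hcut : IsVertexCut G L S R)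
    (KR : Finset V) (hKRsub : KR ⊆ R) (hKRcard : KR.card = k)
    (KL : Finset V) (hKLsub : KL ⊆ L) (hKLcard : KL.card = k) :
    (∀ S' : Finset {v : V // v ∈ L ∪ S ∪ KR}, S'.card < k →
      IsSeparator (kLeftGraph G L S KR) S' →
      IsSeparator G (S'.image Subtype.val)) ∧
    (∀ S' : Finset {v : V // v ∈ R ∪ S ∪ KL}, S'.card < k →
      IsSeparator (kLeftGraph G R S KL) S' →
      IsSeparator G (S'.image Subtype.val)) := by
  obtain ⟨-, -, -, -, -, hcover, hLR⟩ := hcut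
  have hcover' : R ∪ S ∪ L = Finset.univ := by
    rw [← hcover, Finset.union_comm (R ∪ S) L, Finset.union_comm R S, Finset.union_assoc]
  exact ⟨fun S' hS' => isSeparator_image_of_kLeftGraph hcover hLR (hKRcard ▸ hS'),
    fun S' hS' => isSeparator_image_of_kLeftGraph hcover'
      (fun x hx y hy hadj => hLR y hy x hx hadj.symm) (hKLcard ▸ hS')⟩
end

section
/- Let G = (V,E) be a finite simple undirected graph, let k ≥ 1, let (L,S,R) be a vertex cut of G, and let G_L be the k-left graph of G with respect to (L,S,R) (vertex set L ∪ S ∪ K_R for some K_R ⊆ R with |K_R| = k; edges: all edges of G inside L ∪ S, all pairs inside K_R, and all pairs between S and K_R). Then for all vertices x, y of G_L, every minimum (x,y)-separator in G_L of size less than k is also an (x,y)-separator in G. The same holds with the k-right graph G_R in place of G_L. -/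
open scoped Classical

variable {V : Type} [Fintype V] [DecidableEq V]

theorem exists_walk_of_map {V W : Type*} {G : SimpleGraph V} {H : SimpleGraph W} (f : V → W)
    {P : V → Prop} {Q : W → Prop}
    (hadj : ∀ u v, G.Adj u v → f u = f v ∨ H.Adj (f u) (f v)) (hPQ : ∀ v, P v → Q (f v))
    {u v : V} (p : G.Walk u v) (hp : ∀ w ∈ p.support, P w) :
    ∃ q : H.Walk (f u) (f v), ∀ w ∈ q.support, Q w := by
  induction p with
  | nil => exact ⟨.nil, by simpa using hPQ _ (hp _ (by simp))⟩
  | @cons a b c hab p ih =>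
    obtain ⟨q, hq⟩ := ih fun w hw => hp w (by simp [hw])
    rcases hadj a b hab with hEq | hAdj
    · rw [hEq]
      exact ⟨q, hq⟩
    · refine ⟨.cons hAdj q, fun w hw => ?_⟩
      rw [SimpleGraph.Walk.support_cons, List.mem_cons] at hw
      rcases hw with rfl | hw
      · exact hPQ _ (hp _ (by simp))
      · exact hq w hw

theorem IsVertexCut.symm {V : Type} [Fintype V] [DecidableEq V] {G : SimpleGraph V}
    {L S R : Finset V} (h : IsVertexCut G L S R) : IsVertexCut G R S L := by
  obtain ⟨hL, hR, hLS, hLR, hSR, hcover, hnadj⟩ := h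
  refine ⟨hR, hL, hSR.symm, hLR.symm, hLS.symm, ?_, fun x hx y hy hxy => hnadj y hy x hx hxy.symm⟩
  rw [← hcover, Finset.union_comm (R ∪ S), Finset.union_comm R, Finset.union_assoc]

/-- A set with fewer elements than `K` that separates two vertices in `kLeftGraph G L S K`
separates them in `G` as well, whether or not it is minimum. -/
theorem IsVertexCut.separates_of_kLeftGraph {V : Type} [Fintype V] [DecidableEq V]
    {G : SimpleGraph V} {L S R K : Finset V} (hcut : IsVertexCut G L S R)
    {x y : {v : V // v ∈ L ∪ S ∪ K}} {C : Finset {v : V // v ∈ L ∪ S ∪ K}}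
    (hcard : C.card < K.card) (hsep : Separates (kLeftGraph G L S K) C x y) :
    Separates G (C.image Subtype.val) (x : V) (y : V) := by
  obtain ⟨-, -, -, hLR, hSR, hcover, hnadj⟩ := hcut
  obtain ⟨hx, hy, hwalk⟩ := hsep
  obtain ⟨z, hzK, hzC⟩ := Finset.exists_mem_notMem_of_card_lt_card
    (Finset.card_image_le.trans_lt hcard : (C.image Subtype.val).card < K.card)
  have hz : z ∈ L ∪ S ∪ K := Finset.mem_union_right _ hzK
  have hval : ∀ v : {v : V // v ∈ L ∪ S ∪ K}, (v : V) ∉ C.image Subtype.val ↔ v ∉ C := by simp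
  refine ⟨(hval x).2 hx, (hval y).2 hy, fun p => ?_⟩
  by_contra! hp
  let f : V → {v : V // v ∈ L ∪ S ∪ K} := fun v =>
    if hv : v ∈ L ∪ S ∪ K then ⟨v, hv⟩ else ⟨z, hz⟩
  have f_val : ∀ v : {v : V // v ∈ L ∪ S ∪ K}, f v = v := fun v => dif_pos v.2
  have f_keep : ∀ v ∈ L ∪ S, (f v : V) = v := fun v hv =>
    congrArg Subtype.val (f_val ⟨v, Finset.mem_union_left _ hv⟩)
  have f_clique : ∀ v ∈ R, (f v : V) ∈ K := by
    intro v hv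
    by_cases hvU : v ∈ L ∪ S ∪ K
    · have hvK : v ∈ K := by
        rcases Finset.mem_union.1 hvU with h | h
        · exact absurd hv (Finset.disjoint_left.1 (Finset.disjoint_union_left.2 ⟨hLR, hSR⟩) h)
        · exact h
      rwa [show f v = ⟨v, hvU⟩ from dif_pos hvU]
    · rwa [show f v = ⟨z, hz⟩ from dif_neg hvU]
  have hmem : ∀ v, v ∈ L ∪ S ∨ v ∈ R := fun v =>
    Finset.mem_union.1 (hcover ▸ Finset.mem_univ v)
  have hS : ∀ u v, G.Adj u v → u ∈ L ∪ S → v ∈ R → u ∈ S := fun u v huv hu hv =>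
    (Finset.mem_union.1 hu).resolve_left fun huL => hnadj u huL v hv huv
  have hadj : ∀ u v, G.Adj u v → f u = f v ∨ (kLeftGraph G L S K).Adj (f u) (f v) := by
    intro u v huv
    refine or_iff_not_imp_left.2 fun hne => (SimpleGraph.fromRel_adj _ _ _).2 ⟨hne, ?_⟩
    rcases hmem u with hu | hu <;> rcases hmem v with hv | hv
    · refine .inl (.inl ?_)
      rw [f_keep u hu, f_keep v hv]
      exact ⟨hu, hv, huv⟩
    · refine .inl (.inr (.inr ⟨?_, f_clique v hv⟩))
      rw [f_keep u hu]
      exact hS u v huv hu hv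
    · refine .inr (.inr (.inr ⟨?_, f_clique u hu⟩))
      rw [f_keep v hv]
      exact hS v u huv.symm hv hu
    · exact .inl (.inr (.inl ⟨f_clique u hu, f_clique v hv⟩))
  have hPQ : ∀ v, v ∉ C.image Subtype.val → f v ∉ C := by
    intro v hv
    by_cases hvU : v ∈ L ∪ S ∪ K
    · rw [show f v = ⟨v, hvU⟩ from dif_pos hvU]
      exact (hval ⟨v, hvU⟩).1 hv
    · rw [show f v = ⟨z, hz⟩ from dif_neg hvU]
      exact (hval ⟨z, hz⟩).1 hzC
  have hlift := exists_walk_of_map (Q := (· ∉ C)) f hadj hPQ p hp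
  rw [f_val, f_val] at hlift
  obtain ⟨q, hq⟩ := hlift
  obtain ⟨w, hw, hwC⟩ := hwalk q
  exact hq w hw hwC

/-- for all vertices `x, y` of the `k`-left graph `G_L` (resp. the
`k`-right graph `G_R`), every minimum `(x,y)`-separator in `G_L` (resp. `G_R`) of
size less than `k` is also an `(x,y)`-separator in `G`. -/
theorem statement_3 {V : Type} [Fintype V] [DecidableEq V]
    (G : SimpleGraph V) (k : ℕ) (hk : 1 ≤ k)
    (L S R : Finset V) (hcut : IsVertexCut G L S R)
    (KR : Finset V) (hKRsub : KR ⊆ R) (hKRcard : KR.card = k)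
    (KL : Finset V) (hKLsub : KL ⊆ L) (hKLcard : KL.card = k) :
    (∀ (x y : {v : V // v ∈ L ∪ S ∪ KR}) (S' : Finset {v : V // v ∈ L ∪ S ∪ KR}),
      S'.card < k →
      Separates (kLeftGraph G L S KR) S' x y →
      (∀ S'' : Finset {v : V // v ∈ L ∪ S ∪ KR},
        Separates (kLeftGraph G L S KR) S'' x y → S'.card ≤ S''.card) →
      Separates G (S'.image Subtype.val) (x : V) (y : V)) ∧
    (∀ (x y : {v : V // v ∈ R ∪ S ∪ KL}) (S' : Finset {v : V // v ∈ R ∪ S ∪ KL}),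
      S'.card < k →
      Separates (kLeftGraph G R S KL) S' x y →
      (∀ S'' : Finset {v : V // v ∈ R ∪ S ∪ KL},
        Separates (kLeftGraph G R S KL) S'' x y → S'.card ≤ S''.card) →
      Separates G (S'.image Subtype.val) (x : V) (y : V)) := by
  subst hKRcard
  exact ⟨fun x y C hC hsep _ => hcut.separates_of_kLeftGraph hC hsep,
    fun x y C hC hsep _ =>
      hcut.symm.separates_of_kLeftGraph (hKLcard ▸ hC) hsep⟩
end

section
/- There is an absolute constant C such that for all integers t ≥ 2 and β ≥ 2 the following holds. For every set T with |T| = t there exists a family 𝒯 of subsets of T with |𝒯| ≤ C·β²·(log t)⁴ such that: for every finite simple undirected graph G containing T among its vertices and every T-Steiner cut (L,S,R) of G that is (T,β)-unbalanced, there exists T' ∈ 𝒯 such that (L,S,R) isolates T' or (R,S,L) isolates T'. -/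
open scoped Classical

variable {V : Type} [Fintype V] [DecidableEq V]

open Polynomial in
/-- The polynomial over `ZMod q` whose coefficients are the `k` lowest base-`q` digits of `n`. -/
noncomputable def digitPoly (q : ℕ) : ℕ → ℕ → (ZMod q)[X]
  | 0, _ => 0
  | k + 1, n => C (n : ZMod q) + X * digitPoly q k (n / q)

theorem digitPoly_zero_right (q k : ℕ) : digitPoly q k 0 = 0 := by
  induction k with
  | zero => rfl
  | succ k ih => simp [digitPoly, ih]

theorem natDegree_digitPoly_le (q k n : ℕ) : (digitPoly q k n).natDegree ≤ k := by
  induction k generalizing n with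
  | zero => simp [digitPoly]
  | succ k ih =>
    refine (Polynomial.natDegree_add_le _ _).trans (max_le (by simp) ?_)
    refine Polynomial.natDegree_mul_le.trans ?_
    have := ih (n / q)
    have := Polynomial.natDegree_X_le (R := ZMod q)
    omega

theorem digitPoly_injOn (q k : ℕ) : Set.InjOn (digitPoly q k) {n | n < q ^ k} := by
  induction k with
  | zero =>
    intro m hm n hn _
    simp only [pow_zero, Set.mem_ofPred_eq] at hm hn
    omega
  | succ k ih =>
    intro m hm n hn h
    simp only [Set.mem_ofPred_eq, pow_succ'] at hm hn
    have h₀ : (m : ZMod q) = n := by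
      simpa [digitPoly] using congrArg (fun p => Polynomial.coeff p 0) h
    have h₁ : digitPoly q k (m / q) = digitPoly q k (n / q) := by
      rw [digitPoly, digitPoly, h₀] at h
      exact Polynomial.isRegular_X.left (add_left_cancel h)
    have hdiv : m / q = n / q :=
      ih (Nat.div_lt_of_lt_mul hm) (Nat.div_lt_of_lt_mul hn) h₁
    have hmod : m % q = n % q := (ZMod.natCast_eq_natCast_iff' m n q).1 h₀
    rw [← Nat.div_add_mod m q, ← Nat.div_add_mod n q, hdiv, hmod]

/-- Two distinct numbers below `q ^ k` have digit polynomials agreeing in at most `k` points. -/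
theorem card_digitPoly_eval_eq_le {q k m n : ℕ} [Fact q.Prime] (hm : m < q ^ k)
    (hn : n < q ^ k) (hmn : m ≠ n) :
    (Finset.univ.filter fun x : ZMod q =>
      (digitPoly q k m).eval x = (digitPoly q k n).eval x).card ≤ k := by
  have hne : digitPoly q k m - digitPoly q k n ≠ 0 :=
    sub_ne_zero.2 fun h => hmn (digitPoly_injOn q k hm hn h)
  calc _ ≤ (digitPoly q k m - digitPoly q k n).roots.toFinset.card := by
        refine Finset.card_le_card fun x hx => ?_
        simp only [Finset.mem_filter, Finset.mem_univ, true_and] at hx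
        simp [hne, hx]
    _ ≤ _ := (Multiset.toFinset_card_le _).trans (Polynomial.card_roots' _)
    _ ≤ k := (Polynomial.natDegree_sub_le _ _).trans
        (max_le (natDegree_digitPoly_le q k m) (natDegree_digitPoly_le q k n))

theorem eval_digitPoly_val {q : ℕ} [Fact q.Prime] (k : ℕ) (x y : ZMod q) :
    (digitPoly q (k + 1) y.val).eval x = y := by
  simp [digitPoly, Nat.div_eq_of_lt (ZMod.val_lt y), digitPoly_zero_right]

theorem eval_digitPoly_add_val {q : ℕ} [Fact q.Prime] (k : ℕ) (x y : ZMod q) :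
    (digitPoly q (k + 2) (q + (y - x).val)).eval x = y := by
  have hq : 1 < q := (Fact.out : q.Prime).one_lt
  have hdiv : (q + (y - x).val) / q = 1 := by
    rw [Nat.add_div_left _ (by omega), Nat.div_eq_of_lt (ZMod.val_lt _)]
  simp [digitPoly, hdiv, Nat.div_eq_of_lt hq, digitPoly_zero_right]

/-- A family of polynomial hash classes isolating every element of every small set. -/
theorem exists_isolating_family_of_prime {α : Type*} [DecidableEq α] (T : Finset α)
    {q k β : ℕ} (hq : q.Prime) (hβ : β * (k + 2) < q) (hT : 2 * q ≤ T.card)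
    (hk : T.card ≤ q ^ (k + 2)) :
    ∃ Fam : Finset (Finset α), (∀ T' ∈ Fam, T' ⊆ T) ∧ Fam.card ≤ q ^ 2 ∧
      ∀ D ⊆ T, D.card < β → ∀ a ∈ D, ∃ T' ∈ Fam, T' ∩ D = {a} ∧ (T' \ D).Nonempty := by
  have : Fact q.Prime := ⟨hq⟩
  let e := T.equivFin
  let h : ZMod q → T → ZMod q := fun x v => (digitPoly q (k + 2) (e v)).eval x
  let cls : ZMod q × ZMod q → Finset α := fun p =>
    (T.attach.filter fun v => h p.1 v = p.2).image Subtype.val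
  have mem_cls : ∀ p v, v ∈ cls p ↔ ∃ hv : v ∈ T, h p.1 ⟨v, hv⟩ = p.2 := by
    intro p v
    simp [cls]
  refine ⟨Finset.univ.image cls, ?_, ?_, ?_⟩
  · intro T' hT'
    obtain ⟨p, -, rfl⟩ := Finset.mem_image.1 hT'
    exact fun v hv => ((mem_cls p v).1 hv).1
  · refine Finset.card_image_le.trans ?_
    simp [ZMod.card, sq]
  intro D hD hDβ a ha
  have lt_pow : ∀ v, (e v : ℕ) < q ^ (k + 2) := fun v => (e v).2.trans_le hk
  let bad : T → Finset (ZMod q) := fun v => Finset.univ.filter fun x => h x ⟨a, hD ha⟩ = h x v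
  have bad_card : ∀ v : T, v.1 ≠ a → (bad v).card ≤ k + 2 := by
    intro v hv
    refine card_digitPoly_eval_eq_le (lt_pow _) (lt_pow _) fun he => hv ?_
    exact congrArg Subtype.val (e.injective (Fin.ext he)).symm
  let I : Finset T := T.attach.filter fun v => v.1 ∈ D.erase a
  obtain ⟨x, hx⟩ : ∃ x, x ∉ I.biUnion bad := by
    by_contra! hall
    have hle : q ≤ (I.biUnion bad).card := by
      rw [Finset.eq_univ_of_forall hall, Finset.card_univ, ZMod.card]
    have hcard : I.card ≤ D.card := by
      refine Finset.card_le_card_of_injOn Subtype.val ?_ Subtype.val_injective.injOn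
      intro v hv
      exact Finset.mem_of_mem_erase (Finset.mem_filter.1 hv).2
    have hmul := Finset.card_biUnion_le_card_mul I bad
      (k + 2) fun v hv => bad_card v (Finset.ne_of_mem_erase (Finset.mem_filter.1 hv).2)
    have := Nat.mul_le_mul_right (k + 2) (hcard.trans hDβ.le)
    omega
  have hinter : cls (x, h x ⟨a, hD ha⟩) ∩ D = {a} := by
    ext v
    simp only [Finset.mem_inter, mem_cls, Finset.mem_singleton]
    constructor
    · rintro ⟨⟨hv, hvx⟩, hvD⟩
      by_contra hva
      refine hx (Finset.mem_biUnion.2 ⟨⟨v, hv⟩, ?_, ?_⟩)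
      · simp [I, hva, hvD]
      · simp [bad, hvx]
    · rintro rfl
      exact ⟨⟨hD ha, rfl⟩, ha⟩
  refine ⟨cls (x, h x ⟨a, hD ha⟩), Finset.mem_image_of_mem _ (Finset.mem_univ _), hinter, ?_⟩
  set y := h x ⟨a, hD ha⟩ with hy
  have hv₀ := ZMod.val_lt y
  have hv₁ := ZMod.val_lt (y - x)
  let n₀ : Fin T.card := ⟨y.val, by omega⟩
  let n₁ : Fin T.card := ⟨q + (y - x).val, by omega⟩
  have hmem₀ : (e.symm n₀ : α) ∈ cls (x, y) :=
    (mem_cls _ _).2 ⟨(e.symm n₀).2, by simpa [h, n₀] using eval_digitPoly_val (k + 1) x y⟩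
  have hmem₁ : (e.symm n₁ : α) ∈ cls (x, y) :=
    (mem_cls _ _).2 ⟨(e.symm n₁).2, by simpa [h, n₁] using eval_digitPoly_add_val k x y⟩
  by_contra hempty
  rw [Finset.not_nonempty_iff_eq_empty, Finset.sdiff_eq_empty_iff_subset] at hempty
  have eq_a : ∀ v ∈ cls (x, y), v = a := fun v hv =>
    Finset.mem_singleton.1 (hinter ▸ Finset.mem_inter.2 ⟨hv, hempty hv⟩)
  have hn : n₀ = n₁ :=
    e.symm.injective (Subtype.ext ((eq_a _ hmem₀).trans (eq_a _ hmem₁).symm))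
  have : y.val = q + (y - x).val := congrArg Fin.val hn
  omega

/-- A set `T` carries a family of `O(β² log² |T|)` subsets isolating every element of every
proper subset of fewer than `β` elements. -/
theorem exists_isolating_family {α : Type*} [DecidableEq α] (T : Finset α) {β : ℕ}
    (hT : 2 ≤ T.card) (hβ : 0 < β) :
    ∃ Fam : Finset (Finset α), (∀ T' ∈ Fam, T' ⊆ T) ∧
      Fam.card ≤ 16 * (β * (Nat.log 2 T.card + 1)) ^ 2 ∧
      ∀ D ⊂ T, D.card < β → ∀ a ∈ D, ∃ T' ∈ Fam, T' ∩ D = {a} ∧ (T' \ D).Nonempty := by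
  obtain ⟨k, hk⟩ : ∃ k, Nat.log 2 T.card = k + 1 :=
    Nat.exists_eq_add_of_le' (Nat.log_pos one_lt_two hT)
  rw [hk]
  obtain ⟨q, hq, hlt, hle⟩ := Nat.exists_prime_lt_and_le_two_mul (β * (k + 2))
    (Nat.mul_pos hβ (by omega)).ne'
  have hsq : q ^ 2 ≤ 4 * (β * (k + 2)) ^ 2 := by nlinarith
  rcases le_or_gt (2 * q) T.card with hTq | hTq
  · have hpow : T.card ≤ q ^ (k + 2) := by
      refine (Nat.lt_pow_succ_log_self one_lt_two T.card).le.trans ?_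
      rw [hk]
      exact Nat.pow_le_pow_left hq.two_le _
    obtain ⟨Fam, hsub, hcard, hiso⟩ := exists_isolating_family_of_prime T hq hlt hTq hpow
    refine ⟨Fam, hsub, hcard.trans ?_, fun D hD => hiso D hD.subset⟩
    show q ^ 2 ≤ 16 * (β * (k + 2)) ^ 2
    omega
  · refine ⟨(T ×ˢ T).image fun p => {p.1, p.2}, ?_, ?_, ?_⟩
    · intro T' hT'
      obtain ⟨p, hp, rfl⟩ := Finset.mem_image.1 hT'
      rw [Finset.mem_product] at hp
      simp [Finset.insert_subset_iff, hp]
    · refine Finset.card_image_le.trans ?_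
      rw [Finset.card_product]
      show T.card * T.card ≤ 16 * (β * (k + 2)) ^ 2
      nlinarith
    · intro D hD _ a ha
      obtain ⟨c, hcT, hcD⟩ := Finset.exists_of_ssubset hD
      refine ⟨{a, c}, Finset.mem_image.2 ⟨(a, c), by simp [hD.subset ha, hcT], rfl⟩, ?_, c, ?_⟩
      · ext v
        simp only [Finset.mem_inter, Finset.mem_insert, Finset.mem_singleton]
        constructor
        · rintro ⟨rfl | rfl, hv⟩
          · rfl
          · exact absurd hv hcD
        · rintro rfl
          exact ⟨Or.inl rfl, ha⟩
      · simp [hcD]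

theorem isolates_of_inter_eq_singleton {α : Type} [Fintype α] [DecidableEq α]
    {T L S R T' : Finset α} {a : α} (hLS : Disjoint L S) (hcover : L ∪ S ∪ R = Finset.univ)
    (hT' : T' ⊆ T) (haL : a ∈ L) (hinter : T' ∩ (T ∩ (L ∪ S)) = {a})
    (hne : (T' \ (T ∩ (L ∪ S))).Nonempty) : Isolates L S R T' := by
  have key : ∀ v, v ∈ T' → v ∈ L ∪ S → v = a := fun v hv hvLS =>
    Finset.mem_singleton.1 (hinter ▸ by simp [hv, hT' hv, Finset.mem_union.1 hvLS])
  have haT' : a ∈ T' := by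
    have : a ∈ T' ∩ (T ∩ (L ∪ S)) := hinter ▸ Finset.mem_singleton_self a
    exact (Finset.mem_inter.1 this).1
  refine ⟨Finset.card_eq_one.2 ⟨a, ?_⟩, Finset.card_eq_zero.2 ?_, Finset.card_pos.2 ?_⟩
  · ext v
    simp only [Finset.mem_inter, Finset.mem_singleton]
    constructor
    · exact fun hv => key v hv.1 (Finset.mem_union_left _ hv.2)
    · rintro rfl
      exact ⟨haT', haL⟩
  · refine Finset.eq_empty_of_forall_notMem fun v hv => ?_
    rw [Finset.mem_inter] at hv
    have := key v hv.1 (Finset.mem_union_right _ hv.2)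
    exact Finset.disjoint_left.1 hLS haL (this ▸ hv.2)
  · obtain ⟨c, hc⟩ := hne
    simp only [Finset.mem_sdiff, Finset.mem_inter, not_and] at hc
    have hcR : c ∈ L ∪ S ∪ R := hcover ▸ Finset.mem_univ c
    refine ⟨c, Finset.mem_inter.2 ⟨hc.1, ?_⟩⟩
    exact (Finset.mem_union.1 hcR).resolve_left (hc.2 (hT' hc.1))

/-- `O(β² log² t)` in binary logarithms is `O(β² log⁴ t)` in natural ones, for `t ≥ 2`. -/
theorem natLog_two_bound {t : ℕ} (β : ℕ) (ht : 2 ≤ t) :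
    ((16 * (β * (Nat.log 2 t + 1)) ^ 2 : ℕ) : ℝ) ≤ 1024 * (β : ℝ) ^ 2 * Real.log t ^ 4 := by
  have hlog : (Nat.log 2 t : ℝ) * Real.log 2 ≤ Real.log t := by
    rw [← Real.log_pow]
    refine Real.log_le_log (by positivity) ?_
    exact_mod_cast Nat.pow_log_le_self 2 (by omega)
  have hl2 : (1 / 2 : ℝ) ≤ Real.log 2 := by linarith [Real.log_two_gt_d9]
  have hone : (1 : ℝ) ≤ Nat.log 2 t := by exact_mod_cast Nat.log_pos one_lt_two ht
  have hx : (Nat.log 2 t + 1 : ℝ) ≤ 4 * Real.log t := by nlinarith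
  have hx' : (1 / 2 : ℝ) ≤ Real.log t := by nlinarith
  have hsq : (1 : ℝ) ≤ 4 * Real.log t ^ 2 := by nlinarith
  push_cast
  calc (16 : ℝ) * (β * (Nat.log 2 t + 1)) ^ 2
      ≤ 16 * (β * (4 * Real.log t)) ^ 2 := by gcongr
    _ = 256 * (β : ℝ) ^ 2 * Real.log t ^ 2 * 1 := by ring
    _ ≤ 256 * (β : ℝ) ^ 2 * Real.log t ^ 2 * (4 * Real.log t ^ 2) := by gcongr
    _ = _ := by ring

/-- there is an absolute constant `C` such that for all `t, β ≥ 2` and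
every terminal set `T` with `|T| = t`, there is a family `𝒯` of subsets of `T` of
size at most `C·β²·(log t)⁴` such that every `(T,β)`-unbalanced `T`-Steiner cut
`(L,S,R)` of any graph on a vertex set containing `T` isolates some `T' ∈ 𝒯`
(in one of the two orientations). -/
theorem statement_5 :
    ∃ C : ℝ, 0 < C ∧ ∀ t β : ℕ, 2 ≤ t → 2 ≤ β →
      ∀ (V : Type) [Fintype V] [DecidableEq V] (T : Finset V), T.card = t →
        ∃ Fam : Finset (Finset V),
          (∀ T' ∈ Fam, T' ⊆ T) ∧
          (Fam.card : ℝ) ≤ C * (β : ℝ) ^ 2 * (Real.log t) ^ 4 ∧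
          ∀ (G : SimpleGraph V) (L S R : Finset V),
            IsSteinerCut G T L S R →
            min (T ∩ (L ∪ S)).card (T ∩ (S ∪ R)).card < β →
            ∃ T' ∈ Fam, Isolates L S R T' ∨ Isolates R S L T' := by
  refine ⟨1024, by norm_num, fun t β ht hβ V _ _ T hTt => ?_⟩
  subst hTt
  obtain ⟨Fam, hsub, hcard, hiso⟩ := exists_isolating_family T ht (by omega : 0 < β)
  refine ⟨Fam, hsub, (Nat.cast_le.2 hcard).trans (natLog_two_bound β ht), ?_⟩
  rintro G L S R ⟨⟨-, -, hLS, hLR, hSR, hcover, -⟩, ⟨a, ha⟩, ⟨c, hc⟩⟩ hmin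
  rw [Finset.mem_inter] at ha hc
  have haR : a ∉ R := Finset.disjoint_left.1 hLR ha.2
  have hcL : c ∉ L := Finset.disjoint_right.1 hLR hc.2
  have haS : a ∉ S := Finset.disjoint_left.1 hLS ha.2
  have hcS : c ∉ S := Finset.disjoint_right.1 hSR hc.2
  rcases min_lt_iff.1 hmin with hD | hD
  · have hss : T ∩ (L ∪ S) ⊂ T :=
      (Finset.ssubset_iff_of_subset Finset.inter_subset_left).2 ⟨c, hc.1, by simp [hcL, hcS]⟩
    obtain ⟨T', hT', hinter, hne⟩ := hiso _ hss hD a (by simp [ha])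
    exact ⟨T', hT', Or.inl
      (isolates_of_inter_eq_singleton hLS hcover (hsub T' hT') ha.2 hinter hne)⟩
  · rw [Finset.union_comm S R] at hD
    have hss : T ∩ (R ∪ S) ⊂ T :=
      (Finset.ssubset_iff_of_subset Finset.inter_subset_left).2 ⟨a, ha.1, by simp [haR, haS]⟩
    obtain ⟨T', hT', hinter, hne⟩ := hiso _ hss hD c (by simp [hc])
    have hcover' : R ∪ S ∪ L = Finset.univ := by
      rw [← hcover, Finset.union_comm, Finset.union_comm R S, Finset.union_assoc]
    exact ⟨T', hT', Or.inr
      (isolates_of_inter_eq_singleton hSR.symm hcover' (hsub T' hT') hc.2 hinter hne)⟩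
end

section
/- Let N ≥ 2 and a, b ≥ 1 be integers, and let A, B be disjoint subsets of {0, 1, …, N−1} with |A| ≤ a and |B| ≤ b. Let p₁ < p₂ < p₃ < … be the prime numbers in increasing order. Then there exists an index i with 1 ≤ i ≤ 1 + a·b·⌈log₂ N⌉ such that for all x ∈ A and y ∈ B, x mod p_i ≠ y mod p_i. -/
open scoped Classical

variable {V : Type} [Fintype V] [DecidableEq V]

theorem Nat.card_primeFactors_le_log_two {n : ℕ} (hn : n ≠ 0) :
    n.primeFactors.card ≤ Nat.log 2 n := by
  refine Nat.le_log_of_pow_le one_lt_two ?_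
  calc 2 ^ n.primeFactors.card ≤ ∏ p ∈ n.primeFactors, p :=
        Finset.pow_card_le_prod _ _ _ fun p hp => (Nat.prime_of_mem_primeFactors hp).two_le
    _ ≤ n := Nat.le_of_dvd (Nat.pos_of_ne_zero hn) (Nat.prod_primeFactors_dvd n)

theorem Nat.log_le_ceil_logb {b m n : ℕ} (hb : 1 < b) (hm : m ≠ 0) (hmn : m ≤ n) :
    Nat.log b m ≤ ⌈Real.logb b n⌉₊ := by
  have h : (Nat.log b m : ℝ) ≤ Real.logb b n :=
    (Real.natLog_le_logb m b).trans <|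
      Real.logb_le_logb_of_le (by exact_mod_cast hb)
        (by exact_mod_cast Nat.pos_of_ne_zero hm) (by exact_mod_cast hmn)
  exact_mod_cast h.trans (Nat.le_ceil _)

/-- Among the first `k + 1` primes, one lies outside any given set of at most `k` numbers. -/
theorem Nat.exists_nth_prime_notMem {s : Finset ℕ} {k : ℕ} (hs : s.card ≤ k) :
    ∃ i ≤ k, Nat.nth Nat.Prime i ∉ s := by
  by_contra! h
  have hcard := Finset.card_le_card_of_injOn (s := Finset.range (k + 1)) (t := s)
    (Nat.nth Nat.Prime) (fun i hi => h i (by simpa [Nat.lt_succ_iff] using hi))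
    (Nat.nth_injective Nat.infinite_setOfPred_prime).injOn
  rw [Finset.card_range] at hcard
  omega

/-- for disjoint `A, B ⊆ {0,…,N−1}` with `|A| ≤ a`, `|B| ≤ b`, some
prime among the first `1 + a·b·⌈log₂ N⌉` primes separates all residues of `A`
from all residues of `B`. (`Nat.nth Nat.Prime (i-1)` is the `i`-th prime.) -/
theorem statement_6 (N a b : ℕ) (hN : 2 ≤ N) (ha : 1 ≤ a) (hb : 1 ≤ b)
    (A B : Finset ℕ) (hA : ∀ x ∈ A, x < N) (hB : ∀ y ∈ B, y < N)
    (hdisj : Disjoint A B) (hAcard : A.card ≤ a) (hBcard : B.card ≤ b) :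
    ∃ i : ℕ, 1 ≤ i ∧ i ≤ 1 + a * b * ⌈Real.logb 2 (N : ℝ)⌉₊ ∧
      ∀ x ∈ A, ∀ y ∈ B,
        x % (Nat.nth Nat.Prime (i - 1)) ≠ y % (Nat.nth Nat.Prime (i - 1)) := by
  set c := ⌈Real.logb 2 (N : ℝ)⌉₊
  set bad : Finset ℕ :=
    (A ×ˢ B).biUnion fun z => ((z.1 : ℤ) - z.2).natAbs.primeFactors
  have hne : ∀ x ∈ A, ∀ y ∈ B, ((x : ℤ) - y).natAbs ≠ 0 := fun x hx y hy h =>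
    Finset.disjoint_left.mp hdisj hx (by rwa [show x = y by omega])
  have hcard : bad.card ≤ a * b * c := by
    calc bad.card ≤ (A ×ˢ B).card * c := by
          refine Finset.card_biUnion_le_card_mul _ _ _ fun z hz => ?_
          obtain ⟨hx, hy⟩ := Finset.mem_product.mp hz
          have hxN := hA _ hx
          have hyN := hB _ hy
          exact (Nat.card_primeFactors_le_log_two (hne _ hx _ hy)).trans <|
            by simpa using
              Nat.log_le_ceil_logb one_lt_two (hne _ hx _ hy) (n := N) (by omega)
      _ ≤ a * b * c := by rw [Finset.card_product]; gcongr
  obtain ⟨i, hi, hib⟩ := Nat.exists_nth_prime_notMem hcard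
  refine ⟨i + 1, by omega, by omega, fun x hx y hy hxy => hib ?_⟩
  rw [Nat.add_sub_cancel] at hxy
  refine Finset.mem_biUnion.mpr ⟨(x, y), Finset.mem_product.mpr ⟨hx, hy⟩, ?_⟩
  refine Nat.mem_primeFactors.mpr ⟨Nat.prime_nth_prime i, ?_, hne x hx y hy⟩
  exact Int.natCast_dvd.mp (Nat.modEq_iff_dvd.mp (Nat.ModEq.symm hxy))
end

section
/- Let G = (V_G, E_G) be a finite simple undirected graph that is an (α,β)-vertex expander, let n ≥ 1 and let ρ ≥ 1 be such that |V_G| = ρ·n. Let 𝒫 be a partition of V_G into exactly n parts, each of size ⌊ρ⌋ or ⌈ρ⌉, and let H be the quotient graph on vertex set 𝒫, where two distinct parts P, Q ∈ 𝒫 are adjacent in H if and only if G has an edge with one endpoint in P and the other in Q. Then H is an (α/⌈ρ⌉, β·⌊ρ⌋/⌈ρ⌉)-vertex expander. -/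
open scoped Classical

variable {V : Type} [Fintype V] [DecidableEq V]

theorem mem_nbrFinset {V : Type} [Fintype V] [DecidableEq V] {G : SimpleGraph V}
    {U : Finset V} {w : V} :
    w ∈ nbrFinset G U ↔ w ∉ U ∧ ∃ u ∈ U, G.Adj w u := by
  simp [nbrFinset]

/-- The neighborhood of a union of parts is covered by the parts in the neighborhood
taken in the quotient graph. -/
theorem nbrFinset_biUnion_subset {V : Type} [Fintype V] [DecidableEq V]
    (G : SimpleGraph V) (Ps : Finset (Finset V)) (hcover : Ps.biUnion id = Finset.univ)
    (L : Finset {P : Finset V // P ∈ Ps}) :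
    nbrFinset G (L.biUnion fun P => (P : Finset V)) ⊆
      (nbrFinset (quotientGraph G Ps) L).biUnion fun P => (P : Finset V) := by
  intro w hw
  obtain ⟨hwL, u, hu, hadj⟩ := mem_nbrFinset.1 hw
  obtain ⟨P, hP, huP⟩ := Finset.mem_biUnion.1 hu
  have hw' : w ∈ Ps.biUnion id := hcover ▸ Finset.mem_univ w
  obtain ⟨Q, hQ, hwQ⟩ := Finset.mem_biUnion.1 hw'
  have hQL : (⟨Q, hQ⟩ : {P : Finset V // P ∈ Ps}) ∉ L := fun h =>
    hwL (Finset.mem_biUnion.2 ⟨_, h, hwQ⟩)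
  refine Finset.mem_biUnion.2 ⟨⟨Q, hQ⟩, mem_nbrFinset.2 ⟨hQL, P, hP, ?_⟩, hwQ⟩
  rw [quotientGraph, SimpleGraph.fromRel_adj]
  exact ⟨fun h => hQL (h ▸ hP), Or.inl ⟨w, hwQ, u, huP, hadj⟩⟩

/-- if `G` is an `(α,β)`-vertex expander with `|V_G| = ρ·n` and `Ps`
is a partition of `V_G` into exactly `n` parts of sizes `⌊ρ⌋` or `⌈ρ⌉`, then the
quotient graph on `Ps` is an `(α/⌈ρ⌉, β·⌊ρ⌋/⌈ρ⌉)`-vertex expander. -/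
theorem statement_7 {V : Type} [Fintype V] [DecidableEq V]
    (G : SimpleGraph V) (α β : ℝ) (hα : α ≤ 1) (hβ : 0 ≤ β)
    (hexp : IsVertexExpander G α β)
    (n : ℕ) (hn : 1 ≤ n) (ρ : ℝ) (hρ : 1 ≤ ρ)
    (hcard : (Fintype.card V : ℝ) = ρ * n)
    (Ps : Finset (Finset V)) (hPscard : Ps.card = n)
    (hdisj : ∀ P ∈ Ps, ∀ Q ∈ Ps, P ≠ Q → Disjoint P Q)
    (hcover : Ps.biUnion id = Finset.univ)
    (hsizes : ∀ P ∈ Ps, P.card = ⌊ρ⌋₊ ∨ P.card = ⌈ρ⌉₊) :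
    IsVertexExpander (quotientGraph G Ps)
      (α / (⌈ρ⌉₊ : ℝ)) (β * (⌊ρ⌋₊ : ℝ) / (⌈ρ⌉₊ : ℝ)) := by
  intro L hL
  have hdisjL : (L : Set {P : Finset V // P ∈ Ps}).PairwiseDisjoint
      fun P => (P : Finset V) := fun P _ Q _ hPQ =>
    hdisj P P.2 Q Q.2 fun h => hPQ (Subtype.ext h)
  have hupper (P : {P : Finset V // P ∈ Ps}) : (P : Finset V).card ≤ ⌈ρ⌉₊ := by
    rcases hsizes P P.2 with h | h
    · exact h.trans_le (Nat.floor_le_ceil ρ)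
    · exact h.le
  have hlower (P : {P : Finset V // P ∈ Ps}) : ⌊ρ⌋₊ ≤ (P : Finset V).card := by
    rcases hsizes P P.2 with h | h
    · exact h.ge
    · exact (Nat.floor_le_ceil ρ).trans h.ge
  set U : Finset V := L.biUnion fun P => (P : Finset V) with hU
  have hUupper : (U.card : ℝ) ≤ L.card * ⌈ρ⌉₊ := by
    exact_mod_cast Finset.card_biUnion_le_card_mul L _ _ fun P _ => hupper P
  have hUlower : (L.card : ℝ) * ⌊ρ⌋₊ ≤ U.card := by
    rw [hU, Finset.card_biUnion hdisjL]
    exact_mod_cast Finset.card_nsmul_le_sum L _ _ fun P _ => hlower P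
  have hNupper : ((nbrFinset G U).card : ℝ) ≤
      (nbrFinset (quotientGraph G Ps) L).card * ⌈ρ⌉₊ := by
    exact_mod_cast (Finset.card_le_card (nbrFinset_biUnion_subset G Ps hcover L)).trans
      (Finset.card_biUnion_le_card_mul _ _ _ fun P _ => hupper P)
  have hceil : (0 : ℝ) < ⌈ρ⌉₊ := by
    exact_mod_cast Nat.ceil_pos.2 (zero_lt_one.trans_le hρ)
  have hn0 : (0 : ℝ) < n := by exact_mod_cast hn
  rw [Fintype.card_coe, hPscard, div_mul_eq_mul_div, le_div_iff₀ hceil] at hL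
  have hα0 : 0 ≤ α :=
    nonneg_of_mul_nonneg_left (le_trans (by positivity) hL) hn0
  have hUcard : (U.card : ℝ) ≤ α * Fintype.card V := by
    refine (hUupper.trans hL).trans (mul_le_mul_of_nonneg_left ?_ hα0)
    rw [hcard]
    exact le_mul_of_one_le_left hn0.le hρ
  rw [div_mul_eq_mul_div, div_le_iff₀ hceil]
  calc β * ⌊ρ⌋₊ * L.card = β * (L.card * ⌊ρ⌋₊) := by ring
    _ ≤ β * U.card := mul_le_mul_of_nonneg_left hUlower hβ
    _ ≤ (nbrFinset G U).card := hexp U hUcard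
    _ ≤ _ := hNupper
end

section
/- Let G = (V,E) be a finite simple undirected non-complete graph with vertex connectivity κ_G, let ε ∈ (0,1], and suppose the minimum degree of G is at least (1+ε)·κ_G. Let (L,S,R) be a minimum vertex cut of G (so |S| = κ_G), and let X be a finite simple undirected graph on the same vertex set V that is an (α, 2/ε)-vertex expander for some α with |L| ≤ α·|V|. Then X contains an edge with one endpoint in L and the other endpoint in R. -/
open scoped Classical

variable {V : Type} [Fintype V] [DecidableEq V]

/-- A vertex on the left side of a vertex cut has all its neighbors in `L ∪ S`. -/
theorem IsVertexCut.degree_lt {V : Type} [Fintype V] [DecidableEq V]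
    {G : SimpleGraph V} [DecidableRel G.Adj] {L S R : Finset V}
    (hcut : IsVertexCut G L S R) {v : V} (hv : v ∈ L) :
    G.degree v < L.card + S.card := by
  obtain ⟨-, -, -, -, -, hcover, hadj⟩ := hcut
  rw [← G.card_neighborFinset_eq_degree v]
  refine (Finset.card_lt_card (t := L ∪ S) ?_).trans_le (Finset.card_union_le L S)
  refine Finset.ssubset_iff_of_subset ?_ |>.2
    ⟨v, Finset.mem_union_left S hv, G.notMem_neighborFinset_self v⟩
  intro w hw
  have hmem := Finset.mem_univ w
  rw [← hcover, Finset.mem_union] at hmem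
  exact hmem.resolve_right fun hwR => hadj v hv w hwR ((G.mem_neighborFinset v w).1 hw)

/-- If `L` has more than `|S|` neighbors in `X`, then `X` has an edge from `L` to `R`. -/
theorem IsVertexCut.exists_adj_of_card_lt {V : Type} [Fintype V] [DecidableEq V]
    {G X : SimpleGraph V} {L S R : Finset V} (hcut : IsVertexCut G L S R)
    (hcard : S.card < (nbrFinset X L).card) :
    ∃ s ∈ L, ∃ t ∈ R, X.Adj s t := by
  obtain ⟨-, -, -, -, -, hcover, -⟩ := hcut
  obtain ⟨w, hw, hwS⟩ := Finset.exists_mem_notMem_of_card_lt_card hcard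
  obtain ⟨-, hwL, u, hu, hwu⟩ := Finset.mem_filter.1 hw
  have hmem := Finset.mem_univ w
  simp only [← hcover, Finset.mem_union, hwL, hwS, false_or] at hmem
  exact ⟨u, hu, w, hmem, hwu.symm⟩

/-- if `G` is non-complete with min degree ≥ `(1+ε)·κ_G`, `(L,S,R)`
is a minimum vertex cut, and `X` is an `(α, 2/ε)`-vertex expander on the same
vertex set with `|L| ≤ α·|V|`, then `X` has an edge between `L` and `R`. -/
theorem statement_11 {V : Type} [Fintype V] [DecidableEq V]
    (G : SimpleGraph V) [DecidableRel G.Adj]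
    (hnc : ∃ x y : V, x ≠ y ∧ ¬ G.Adj x y)
    (ε : ℝ) (hε0 : 0 < ε) (hε1 : ε ≤ 1)
    (hdeg : ∀ v : V, (1 + ε) * (vconn G : ℝ) ≤ (G.degree v : ℝ))
    (L S R : Finset V) (hcut : IsVertexCut G L S R) (hmin : S.card = vconn G)
    (X : SimpleGraph V) (α : ℝ)
    (hX : IsVertexExpander X α (2 / ε))
    (hL : (L.card : ℝ) ≤ α * (Fintype.card V : ℝ)) :
    ∃ s ∈ L, ∃ t ∈ R, X.Adj s t := by
  refine hcut.exists_adj_of_card_lt ?_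
  obtain ⟨v, hv⟩ := hcut.1
  have hlt : (G.degree v : ℝ) < L.card + S.card := mod_cast hcut.degree_lt hv
  have hdegv := hdeg v
  rw [← hmin] at hdegv
  have hS : (S.card : ℝ) < L.card / ε := by
    rw [lt_div_iff₀ hε0]
    linarith
  have hexp : 2 * (L.card / ε) ≤ ((nbrFinset X L).card : ℝ) := by
    have h := hX L hL
    rwa [div_mul_eq_mul_div, mul_div_assoc] at h
  have hnonneg : (0 : ℝ) ≤ S.card := Nat.cast_nonneg _
  exact_mod_cast (by linarith : (S.card : ℝ) < (nbrFinset X L).card)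
end

section
/- Let G = (V,E) be a finite simple undirected graph with terminal set T ⊆ V. Let (L,S,R) be a vertex cut of G and let (L',S',R') be a minimum T-Steiner cut of G (i.e., a T-Steiner cut with |S'| = κ_G(T)). Suppose S ∩ R' = ∅, T ∩ L' ≠ ∅, and there exists a terminal t ∈ T ∩ L ∩ R'. Then S' ∩ R = ∅, i.e., S' ⊆ L ∪ S. Moreover, the neighborhood N_G(L ∩ R') is contained in S' and is itself the separator of a T-Steiner cut of G. -/
open scoped Classical

variable {V : Type} [Fintype V] [DecidableEq V]

/-- Any set separating two distinct terminals has at least `κ_G(T)` elements. -/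
theorem kappaT_le_card_of_separates {V : Type} [Fintype V] (G : SimpleGraph V)
    {T C : Finset V} {x y : V} (hx : x ∈ T) (hy : y ∈ T) (hxy : x ≠ y)
    (h : Separates G C x y) : kappaT G T ≤ C.card := by
  have hT : 2 ≤ T.card := Finset.one_lt_card.2 ⟨x, hx, y, hy, hxy⟩
  have hpair : kappaPair G x y ≤ C.card := by
    rw [kappaPair, if_pos ⟨C, h⟩]
    exact Nat.sInf_le ⟨C, h, rfl⟩
  unfold kappaT
  rw [if_pos hT]
  exact le_trans (Nat.sInf_le ⟨x, hx, y, hy, hxy, rfl⟩) hpair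

/-- The neighborhood of `U` separates the vertices of `U` from those outside its closure. -/
theorem separates_nbrFinset {V : Type} [Fintype V] [DecidableEq V] (G : SimpleGraph V)
    {U : Finset V} {x y : V} (hx : x ∈ U) (hy : y ∉ U) (hyN : y ∉ nbrFinset G U) :
    Separates G (nbrFinset G U) x y := by
  refine ⟨fun h => (mem_nbrFinset.1 h).1 hx, hyN, fun p => ?_⟩
  obtain ⟨d, hd, hd₁, hd₂⟩ := p.exists_boundary_dart (U : Set V) hx hy
  exact ⟨d.snd, p.dart_snd_mem_support_of_mem_darts hd,
    mem_nbrFinset.2 ⟨hd₂, d.fst, hd₁, d.adj.symm⟩⟩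

/-- If the separator of `(L,S,R)` avoids `R'`, then a neighbor of `L ∩ R'` lies in `S'` but
not in `R`. -/
theorem nbrFinset_inter_subset {V : Type} [Fintype V] [DecidableEq V] {G : SimpleGraph V}
    {L S R L' S' R' : Finset V} (hcut : IsVertexCut G L S R) (hcut' : IsVertexCut G L' S' R')
    (hSR' : S ∩ R' = ∅) : nbrFinset G (L ∩ R') ⊆ S' \ R := by
  obtain ⟨-, -, -, -, -, hun, hadj⟩ := hcut
  obtain ⟨-, -, -, -, -, hun', hadj'⟩ := hcut'
  intro w hw
  obtain ⟨hwU, u, hu, hwu⟩ := mem_nbrFinset.1 hw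
  obtain ⟨huL, huR'⟩ := Finset.mem_inter.1 hu
  have hwR : w ∉ R := fun h => hadj u huL w h hwu.symm
  have hwL' : w ∉ L' := fun h => hadj' w h u huR' hwu
  have hw₁ : w ∈ L ∪ S ∪ R := hun ▸ Finset.mem_univ w
  have hw₂ : w ∈ L' ∪ S' ∪ R' := hun' ▸ Finset.mem_univ w
  have hwS : ¬ (w ∈ S ∧ w ∈ R') := fun h => by
    simpa [hSR'] using Finset.mem_inter.2 h
  simp only [Finset.mem_union, Finset.mem_inter, Finset.mem_sdiff] at *
  tauto

/-- let `(L,S,R)` be a vertex cut and `(L',S',R')` a minimum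
`T`-Steiner cut with `S ∩ R' = ∅`, `T ∩ L' ≠ ∅`, and some terminal
`t ∈ T ∩ L ∩ R'`. Then `S' ∩ R = ∅` (i.e. `S' ⊆ L ∪ S`), and `N_G(L ∩ R')` is
contained in `S'` and is itself the separator of a `T`-Steiner cut of `G`. -/
theorem statement_12 {V : Type} [Fintype V] [DecidableEq V]
    (G : SimpleGraph V) (T : Finset V)
    (L S R : Finset V) (hcut : IsVertexCut G L S R)
    (L' S' R' : Finset V) (hcut' : IsSteinerCut G T L' S' R')
    (hmin : S'.card = kappaT G T)
    (hSR' : S ∩ R' = ∅)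
    (hTL' : (T ∩ L').Nonempty)
    (ht : ∃ t, t ∈ T ∩ L ∩ R') :
    S' ∩ R = ∅ ∧ S' ⊆ L ∪ S ∧
    nbrFinset G (L ∩ R') ⊆ S' ∧
    ∃ L'' R'' : Finset V, IsSteinerCut G T L'' (nbrFinset G (L ∩ R')) R'' := by
  obtain ⟨t, ht⟩ := ht
  obtain ⟨l, hl⟩ := hTL'
  simp only [Finset.mem_inter] at ht hl
  have hsub := nbrFinset_inter_subset hcut hcut'.1 hSR'
  have hsub' : nbrFinset G (L ∩ R') ⊆ S' := hsub.trans Finset.sdiff_subset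
  obtain ⟨-, -, hLS', hLR', -, -, -⟩ := hcut'.1
  have hlR' : l ∉ R' := Finset.disjoint_left.1 hLR' hl.2
  have hsep : Separates G (nbrFinset G (L ∩ R')) t l :=
    separates_nbrFinset G (Finset.mem_inter.2 ⟨ht.1.2, ht.2⟩)
      (fun h => hlR' (Finset.mem_inter.1 h).2)
      (fun h => Finset.disjoint_left.1 hLS' hl.2 (hsub' h))
  have hcard := kappaT_le_card_of_separates G ht.1.1 hl.1 (fun h => hlR' (h ▸ ht.2)) hsep
  have heq : nbrFinset G (L ∩ R') = S' := Finset.eq_of_subset_of_card_le hsub' (hmin ▸ hcard)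
  have hSR : ∀ v ∈ S', v ∉ R := fun v hv => (Finset.mem_sdiff.1 (hsub (heq ▸ hv))).2
  refine ⟨?_, fun v hv => ?_, hsub', L', R', heq ▸ hcut'⟩
  · exact Finset.disjoint_iff_inter_eq_empty.1 (Finset.disjoint_left.2 hSR)
  · obtain ⟨-, -, -, -, -, hun, -⟩ := hcut
    have hv' : v ∈ L ∪ S ∪ R := hun ▸ Finset.mem_univ v
    exact (Finset.mem_union.1 hv').resolve_right (hSR v hv)
end
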